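/- If the CNF formula φ is unsatisfiable, then every naive extension E of the reduction CAF F_φ with φ ∉ E contains at least one clause-argument cl_i. -/

import Mathlib

/-- A set `E` of arguments is conflict-free w.r.t. attack relation `R`:
no argument in `E` attacks another argument in `E`. -/
def ConflictFree {α : Type*} (R : α → α → Prop) (E : Set α) : Prop :=
  ∀ a ∈ E, ∀ b ∈ E, ¬ R a b

/-- A set `E` is naive iff it is ⊆-maximal among conflict-free sets. -/
def Naive {α : Type*} (R : α → α → Prop) (E : Set α) : Prop :=
  ConflictFree R E ∧ ∀ E', ConflictFree R E' → E ⊆ E' → E' = E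

/-- Inherited naive semantics: claim-sets of naive extensions. -/
def naC {α γ : Type*} (R : α → α → Prop) (cl : α → γ) : Set (Set γ) :=
  {S | ∃ E, Naive R E ∧ S = cl '' E}

/-- Claim-sets of conflict-free sets. -/
def cfC {α γ : Type*} (R : α → α → Prop) (cl : α → γ) : Set (Set γ) :=
  {S | ∃ E, ConflictFree R E ∧ S = cl '' E}

/-- Claim-level naive semantics: ⊆-maximal claim-sets of conflict-free sets. -/
def clNaive {α γ : Type*} (R : α → α → Prop) (cl : α → γ) : Set (Set γ) :=
  {S | S ∈ cfC R cl ∧ ∀ T ∈ cfC R cl, S ⊆ T → T = S}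

/-- A family of sets is incomparable if no member is a strict subset of another. -/
def Incomparable {γ : Type*} (S : Set (Set γ)) : Prop :=
  ∀ S1 ∈ S, ∀ S2 ∈ S, ¬ S1 ⊂ S2

/-- Arguments of the reduction CAF `F_φ` for a CNF formula over atoms `X`
with clause index set `I`: an argument `pos x` for each atom `x`, an argument
`neg x` (i.e. `x̄`) for each atom, an argument `cls i` for each clause,
and the arguments `φ`, `a1`, `a2`. -/
inductive RArg (X I : Type*) where
  | pos : X → RArg X I
  | neg : X → RArg X I
  | cls : I → RArg X I
  | phi : RArg X I
  | a1 : RArg X I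
  | a2 : RArg X I

/-- Claims of the reduction CAF: each atom argument, negated-atom argument,
clause argument and `φ` has its own claim; `a1` and `a2` share the fresh claim `a`. -/
inductive RClaim (X I : Type*) where
  | pos : X → RClaim X I
  | neg : X → RClaim X I
  | cls : I → RClaim X I
  | phi : RClaim X I
  | a : RClaim X I

/-- The claim function of the reduction CAF. -/
def rcl {X I : Type*} : RArg X I → RClaim X I
  | .pos x => .pos x
  | .neg x => .neg x
  | .cls i => .cls i
  | .phi => .phi
  | .a1 => .a
  | .a2 => .a

/-- The attack relation of the reduction CAF, where clause `i` has positive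
literals `P i` and negative literals `N i`:  `x` attacks clause `i` if `x ∈ P i`,
`x̄` attacks clause `i` if `¬x ∈ cl_i` (i.e. `x ∈ N i`), `x` and `x̄` attack each
other, every clause attacks `φ`, and `φ` attacks `a2`. -/
def rAtt {X I : Type*} (P N : I → Set X) : RArg X I → RArg X I → Prop := fun u v =>
  match u, v with
  | .pos x, .cls i => x ∈ P i
  | .neg x, .cls i => x ∈ N i
  | .pos x, .neg y => x = y
  | .neg x, .pos y => x = y
  | .cls _, .phi => True
  | .phi, .a2 => True
  | _, _ => False

/-- No clause contains both a literal and its negation. -/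
def NonTaut {X I : Type*} (P N : I → Set X) : Prop :=
  ∀ i : I, ∀ x : X, ¬ (x ∈ P i ∧ x ∈ N i)

/-- `M ⊆ X` is a model of the CNF formula: every clause contains a positive
literal in `M` or a negative literal whose atom is not in `M`. -/
def IsModel {X I : Type*} (P N : I → Set X) (M : Set X) : Prop :=
  ∀ i : I, (∃ x ∈ P i, x ∈ M) ∨ (∃ x ∈ N i, x ∉ M)

/-- The formula is satisfiable if it has a model. -/
def Satisfiable {X I : Type*} (P N : I → Set X) : Prop :=
  ∃ M : Set X, IsModel P N M

/-- The naive extension `E = M ∪ {x̄ : x ∉ M} ∪ {φ, a1}` built from a model `M`. -/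
def Ephi {X I : Type*} (M : Set X) : Set (RArg X I) :=
  (RArg.pos '' M) ∪ (RArg.neg '' Mᶜ) ∪ {RArg.phi, RArg.a1}

/-- The naive extension `E' = M ∪ {x̄ : x ∉ M} ∪ {a1, a2}` built from a model `M`. -/
def Ea {X I : Type*} (M : Set X) : Set (RArg X I) :=
  (RArg.pos '' M) ∪ (RArg.neg '' Mᶜ) ∪ {RArg.a1, RArg.a2}

/-- A naive set contains every argument that can be added without conflict. -/
theorem Naive.mem_of_conflictFree_insert {α : Type*} {R : α → α → Prop} {E : Set α} {a : α}
    (hE : Naive R E) (ha : ConflictFree R (insert a E)) : a ∈ E :=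
  hE.2 _ ha (Set.subset_insert a E) ▸ Set.mem_insert a E

/-- If `φ` is unsatisfiable, then every naive extension `E` of
`F_φ` with `φ ∉ E` contains at least one clause-argument. -/
theorem unsat_naive_contains_clause {X I : Type*} [Fintype X] [Fintype I]
    (P N : I → Set X) (hNT : NonTaut P N) (hUnsat : ¬ Satisfiable P N)
    (E : Set (RArg X I)) (hE : Naive (rAtt P N) E) (hphi : RArg.phi ∉ E) :
    ∃ i : I, RArg.cls i ∈ E := by
  obtain ⟨i, hi⟩ : ∃ i : I, ¬ ((∃ x ∈ P i, RArg.pos x ∈ E) ∨ ∃ x ∈ N i, RArg.pos x ∉ E) := by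
    by_contra! h
    exact hUnsat ⟨{x | RArg.pos x ∈ E}, fun i => by simpa [or_iff_not_imp_left] using h i⟩
  refine ⟨i, hE.mem_of_conflictFree_insert ?_⟩
  rintro u (rfl | hu) v (rfl | hv) huv
  · exact huv
  · cases v with
    | phi => exact hphi hv
    | _ => exact huv
  · cases u with
    | pos x => exact hi (.inl ⟨x, huv, hu⟩)
    | neg x => exact hi (.inr ⟨x, huv, fun hx => hE.1 _ hx _ hu rfl⟩)
    | _ => exact huv
  · exact hE.1 u hu v hv huv
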